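/- Let n and C be integers with 1 ≤ n ≤ C, and let K' := { g ∈ GL₂(F) : g₁₁ ∈ 1 + pⁿ, g₁₂ ∈ p^C, g₂₁ ∈ ϖ^{n−C}·o, g₂₂ ∈ o^× } (equivalently K' = h·K₁(pⁿ)·h^{−1} with h = diag(ϖ^{C−n}, 1)·w; every such g is automatically invertible). Then T(F) ∩ Z(F)·K' is a subgroup of T(F) of finite index, and its index equals q^C + q^{C−1} if L/F is unramified, and 2·q^C if L/F is ramified. -/

import Mathlib

open scoped Pointwise
open Matrix

noncomputable section

abbrev Zm0 : Type := WithZero (Multiplicative ℤ)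

/-- `ev n` is the value (in `ℤₘ₀ = WithZero (Multiplicative ℤ)`) of an element of additive
valuation `n`; thus `x ∈ 𝔭^n` iff `v x ≤ ev n`, `x ∈ 𝔬` iff `v x ≤ ev 0`, and `x ∈ 𝔬^×` iff
`v x = ev 0`. -/
def ev (n : ℤ) : Zm0 := ((Multiplicative.ofAdd (-n) : Multiplicative ℤ) : Zm0)

variable {F : Type*} [Field F]

/-- the matrix t(x,y) = [[x, cy],[−ay, x−by]] -/
def tmat (a b c x y : F) : Matrix (Fin 2) (Fin 2) F :=
  !![x, c * y; -(a * y), x - b * y]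

/-- the torus T(F) ⊆ GL₂(F), as a set of matrices -/
def TSet (a b c : F) : Set (Matrix (Fin 2) (Fin 2) F) :=
  {m | ∃ x y : F, x ^ 2 - b * x * y + a * c * y ^ 2 ≠ 0 ∧ m = tmat a b c x y}

/-- Z(F): the invertible scalar matrices -/
def ZF (F : Type*) [Field F] : Set (Matrix (Fin 2) (Fin 2) F) :=
  {m | ∃ z : F, z ≠ 0 ∧ m = z • (1 : Matrix (Fin 2) (Fin 2) F)}

/-- the compact subgroup
K' = { g : g₁₁ ∈ 1 + 𝔭ⁿ, g₁₂ ∈ 𝔭^C, g₂₁ ∈ ϖ^{n−C}·𝔬, g₂₂ ∈ 𝔬^× } -/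
def Kp (v : Valuation F Zm0) (n C : ℕ) : Set (Matrix (Fin 2) (Fin 2) F) :=
  {g | v (g 0 0 - 1) ≤ ev n ∧ v (g 0 1) ≤ ev C ∧
       v (g 1 0) ≤ ev ((n : ℤ) - C) ∧ v (g 1 1) = ev 0}


lemma ev_zero : ev 0 = 1 := by simp [ev]

lemma ev_add (m n : ℤ) : ev (m + n) = ev m * ev n := by
  unfold ev
  rw [← WithZero.coe_mul, ← ofAdd_add]
  congr 2
  ring

lemma ev_le_iff (m n : ℤ) : ev m ≤ ev n ↔ n ≤ m := by
  unfold ev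
  rw [WithZero.coe_le_coe, Multiplicative.ofAdd_le, neg_le_neg_iff]

lemma ev_lt_iff (m n : ℤ) : ev m < ev n ↔ n < m := by
  unfold ev
  rw [WithZero.coe_lt_coe, Multiplicative.ofAdd_lt, neg_lt_neg_iff]

lemma ev_inj_iff (m n : ℤ) : ev m = ev n ↔ m = n := by
  simp [ev]

lemma ev_ne (m : ℤ) : ev m ≠ 0 := by simp [ev]

lemma ev_pos (m : ℤ) : 0 < ev m := zero_lt_iff.2 (ev_ne m)

lemma ev_exists (x : Zm0) (hx : x ≠ 0) : ∃ n : ℤ, x = ev n := by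
  induction x using WithZero.recZeroCoe with
  | zero => exact absurd rfl hx
  | coe y => exact ⟨-(Multiplicative.toAdd y), by simp [ev]⟩

lemma ev_pow (m : ℤ) (k : ℕ) : ev m ^ k = ev (k * m) := by
  induction k with
  | zero => simp [ev_zero]
  | succ k ih => rw [pow_succ, ih, ← ev_add]; congr 1; push_cast; ring

lemma lt_one_iff (x : Zm0) : x < 1 ↔ x ≤ ev 1 := by
  by_cases hx : x = 0
  · subst hx; simp
  · obtain ⟨n, rfl⟩ := ev_exists x hx
    rw [← ev_zero, ev_lt_iff, ev_le_iff]; omega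

lemma lt_ev_one_iff (x : Zm0) : x < ev 1 ↔ x ≤ ev 2 := by
  by_cases hx : x = 0
  · subst hx; simp [ev_pos]
  · obtain ⟨n, rfl⟩ := ev_exists x hx
    rw [ev_lt_iff, ev_le_iff]; omega

lemma parity (k m : Zm0) (h : k ^ 2 * ev 1 = m ^ 2) : k = 0 := by
  by_contra hk
  have hm : m ≠ 0 := by
    rintro rfl
    have := ev_ne 1
    simp [hk, this] at h
  obtain ⟨i, rfl⟩ := ev_exists k hk
  obtain ⟨j, rfl⟩ := ev_exists m hm
  rw [ev_pow, ev_pow, ← ev_add, ev_inj_iff] at h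
  push_cast at h
  omega

lemma sq_le_sq_iff (x y : Zm0) : x ^ 2 ≤ y ^ 2 ↔ x ≤ y :=
  pow_le_pow_iff_left₀ zero_le zero_le (by norm_num)

lemma sq_eq_sq_iff (x y : Zm0) : x ^ 2 = y ^ 2 ↔ x = y :=
  pow_left_inj₀ zero_le zero_le (by norm_num)

/-- the norm form -/
def Nf (a b c x y : F) : F := x ^ 2 - b * x * y + a * c * y ^ 2

lemma v_rem {v : Valuation F Zm0} {a b c : F} (ha : v a ≤ 1) (hb : v b ≤ 1) (hc : v c = 1)
    {x y : F} : v (-(b * x * y) + a * c * y ^ 2) ≤ v y * max (v x) (v y) := by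
  have e : -(b * x * y) + a * c * y ^ 2 = y * (-(b * x) + a * c * y) := by ring
  rw [e, map_mul]
  gcongr
  refine (v.map_add _ _).trans (max_le_max ?_ ?_)
  · rw [Valuation.map_neg, map_mul]
    exact mul_le_of_le_one_left' hb
  · rw [map_mul, map_mul, hc, mul_one]
    exact mul_le_of_le_one_left' ha

lemma vNf_dom {v : Valuation F Zm0} {a b c : F} (ha : v a ≤ 1) (hb : v b ≤ 1) (hc : v c = 1)
    {x y : F} (h : v y < v x) : v (Nf a b c x y) = v x ^ 2 := by
  have e : Nf a b c x y = x ^ 2 + (-(b * x * y) + a * c * y ^ 2) := by unfold Nf; ring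
  rw [e, Valuation.map_add_eq_of_lt_left, map_pow]
  refine (v_rem ha hb hc).trans_lt ?_
  rw [max_eq_left h.le, map_pow, sq]
  have hx : 0 < v x := lt_of_le_of_lt zero_le h
  exact mul_lt_mul_of_pos_right h hx

lemma vNf_le {v : Valuation F Zm0} {a b c : F} (ha : v a ≤ 1) (hb : v b ≤ 1) (hc : v c = 1)
    (x y : F) : v (Nf a b c x y) ≤ max (v x) (v y) ^ 2 := by
  have e : Nf a b c x y = x ^ 2 + (-(b * x * y) + a * c * y ^ 2) := by unfold Nf; ring
  rw [e]
  refine (v.map_add _ _).trans (max_le ?_ ?_)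
  · rw [map_pow]
    exact pow_le_pow_left₀ zero_le (le_max_left _ _) 2
  · refine (v_rem ha hb hc).trans ?_
    rw [sq]
    gcongr
    exact le_max_right _ _

lemma ev_lt_one {C : ℕ} (hC : 1 ≤ C) : ev C < 1 := by
  rw [← ev_zero, ev_lt_iff]; omega

lemma dom_lt {v : Valuation F Zm0} {C : ℕ} (hC : 1 ≤ C) {x y : F} (hx : x ≠ 0)
    (h : v y ≤ ev C * v x) : v y < v x := by
  refine h.trans_lt ?_
  have hx : 0 < v x := zero_lt_iff.2 ((v.ne_zero_iff).2 hx)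
  exact mul_lt_of_lt_one_left hx (ev_lt_one hC)

lemma tmat_mul (a b c x y x' y' : F) : tmat a b c x y * tmat a b c x' y' =
    tmat a b c (x * x' - a * c * (y * y')) (x * y' + y * x' - b * (y * y')) := by
  ext i j
  fin_cases i <;> fin_cases j <;> simp [tmat, Matrix.mul_apply, Fin.sum_univ_two] <;> ring

lemma tmat_inj {a b c x y x' y' : F} (hc : c ≠ 0) (h : tmat a b c x y = tmat a b c x' y') :
    x = x' ∧ y = y' := by
  have h1 := congrFun (congrFun h 0) 0
  have h2 := congrFun (congrFun h 0) 1
  simp [tmat] at h1 h2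
  exact ⟨h1, h2.resolve_right hc⟩

lemma tmat_one (a b c : F) : tmat a b c 1 0 = 1 := by
  ext i j
  fin_cases i <;> fin_cases j <;> simp [tmat]

lemma memH_iff {v : Valuation F Zm0} {a b c : F} (ha : v a ≤ 1) (hb : v b ≤ 1) (hc : v c = 1)
    {n C : ℕ} (hn : 1 ≤ n) (hnC : n ≤ C) (m : Matrix (Fin 2) (Fin 2) F) :
    m ∈ TSet a b c ∩ (ZF F * Kp v n C) ↔
      ∃ x y : F, x ≠ 0 ∧ v y ≤ ev C * v x ∧ m = tmat a b c x y := by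
  have hC : 1 ≤ C := hn.trans hnC
  constructor
  · rintro ⟨⟨x, y, -, rfl⟩, hm⟩
    obtain ⟨z', ⟨z, hz, rfl⟩, g, ⟨h1, h2, -, -⟩, h⟩ := Set.mem_mul.1 hm
    rw [smul_mul_assoc, one_mul] at h
    have e1 := congrFun (congrFun h 0) 0
    have e2 := congrFun (congrFun h 0) 1
    simp [tmat] at e1 e2
    have hg : v (g 0 0) = 1 := by
      have : g 0 0 = 1 + (g 0 0 - 1) := by ring
      rw [this, Valuation.map_add_eq_of_lt_left, map_one]
      rw [map_one]
      exact h1.trans_lt (ev_lt_one hn)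
    have hx : v x = v z := by rw [← e1, map_mul, hg, mul_one]
    refine ⟨x, y, ?_, ?_, rfl⟩
    · rw [← v.ne_zero_iff, hx, v.ne_zero_iff]; exact hz
    · have : v y = v (c * y) := by rw [map_mul, hc, one_mul]
      rw [this, ← e2, map_mul, hx, mul_comm]
      gcongr
  · rintro ⟨x, y, hx, hxy, rfl⟩
    have hlt := dom_lt hC hx hxy
    have hvx : v x ≠ 0 := (v.ne_zero_iff).2 hx
    have hyx : v (y / x) ≤ ev C := by
      rw [map_div₀]
      exact div_le_of_le_mul₀ zero_le zero_le hxy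
    refine ⟨⟨x, y, ?_, rfl⟩, ?_⟩
    · have := vNf_dom ha hb hc hlt
      intro h0
      unfold Nf at this
      rw [h0, map_zero] at this
      exact pow_ne_zero 2 hvx this.symm
    · refine Set.mem_mul.2 ⟨x • 1, ⟨x, hx, rfl⟩, tmat a b c 1 (y / x), ⟨?_, ?_, ?_, ?_⟩, ?_⟩
      · simp [tmat]
      · simp only [tmat, Matrix.of_apply, Matrix.cons_val', Matrix.cons_val_zero, Matrix.cons_val_one]
        rw [map_mul, hc, one_mul]; exact hyx
      · simp only [tmat, Matrix.of_apply, Matrix.cons_val', Matrix.cons_val_zero, Matrix.cons_val_one]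
        rw [Valuation.map_neg, map_mul]
        refine (mul_le_of_le_one_left' ha).trans (hyx.trans ?_)
        rw [ev_le_iff]; omega
      · simp only [tmat, Matrix.of_apply, Matrix.cons_val', Matrix.cons_val_zero, Matrix.cons_val_one]
        rw [sub_eq_add_neg, Valuation.map_add_eq_of_lt_left, map_one, ev_zero]
        rw [map_one, Valuation.map_neg, map_mul]
        exact ((mul_le_of_le_one_left' hb).trans hyx).trans_lt (ev_lt_one hC)
      · rw [smul_mul_assoc, one_mul]
        ext i j
        fin_cases i <;> fin_cases j <;> simp [tmat] <;> field_simp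

lemma subgroup_part {v : Valuation F Zm0} {a b c : F} (ha : v a ≤ 1) (hb : v b ≤ 1) (hc : v c = 1)
    {n C : ℕ} (hn : 1 ≤ n) (hnC : n ≤ C) :
    ((1 : Matrix (Fin 2) (Fin 2) F) ∈ TSet a b c ∩ (ZF F * Kp v n C)
      ∧ (∀ x ∈ TSet a b c ∩ (ZF F * Kp v n C), ∀ y ∈ TSet a b c ∩ (ZF F * Kp v n C),
          x * y ∈ TSet a b c ∩ (ZF F * Kp v n C))
      ∧ (∀ x ∈ TSet a b c ∩ (ZF F * Kp v n C), ∃ y ∈ TSet a b c ∩ (ZF F * Kp v n C),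
          x * y = 1 ∧ y * x = 1)) := by
  have hC : 1 ≤ C := hn.trans hnC
  simp only [memH_iff ha hb hc hn hnC]
  refine ⟨⟨1, 0, one_ne_zero, by simp, (tmat_one a b c).symm⟩, ?_, ?_⟩
  · rintro _ ⟨x, y, hx, hxy, rfl⟩ _ ⟨x', y', hx', hxy', rfl⟩
    have hlt := dom_lt hC hx hxy
    have hlt' := dom_lt hC hx' hxy'
    have hvx : 0 < v x := zero_lt_iff.2 ((v.ne_zero_iff).2 hx)
    have hvx' : 0 < v x' := zero_lt_iff.2 ((v.ne_zero_iff).2 hx')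
    have hyy : v (y * y') < v (x * x') := by
      rw [map_mul, map_mul]
      exact mul_lt_mul'' hlt hlt' zero_le zero_le
    have h1 : v (x * x' - a * c * (y * y')) = v (x * x') := by
      rw [sub_eq_add_neg, Valuation.map_add_eq_of_lt_left]
      rw [Valuation.map_neg, map_mul, map_mul v a, hc, mul_one]
      exact (mul_le_of_le_one_left' ha).trans_lt hyy
    refine ⟨_, _, ?_, ?_, tmat_mul _ _ _ _ _ _ _⟩
    · rw [← v.ne_zero_iff, h1, v.ne_zero_iff]; exact mul_ne_zero hx hx'
    · rw [h1, map_mul, sub_eq_add_neg]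
      refine (v.map_add _ _).trans (max_le ((v.map_add _ _).trans (max_le ?_ ?_)) ?_)
      · rw [map_mul, mul_left_comm]; gcongr
      · rw [map_mul, ← mul_assoc]; gcongr
      · rw [Valuation.map_neg, map_mul, map_mul]
        refine (mul_le_of_le_one_left' hb).trans ?_
        rw [← mul_assoc]
        exact mul_le_mul' hxy hlt'.le
  · rintro _ ⟨x, y, hx, hxy, rfl⟩
    have hlt := dom_lt hC hx hxy
    have hN := vNf_dom ha hb hc hlt
    have hvx : v x ≠ 0 := (v.ne_zero_iff).2 hx
    have hN0 : Nf a b c x y ≠ 0 := by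
      rw [← v.ne_zero_iff, hN]; exact pow_ne_zero 2 hvx
    have h1 : v (x - b * y) = v x := by
      rw [sub_eq_add_neg, Valuation.map_add_eq_of_lt_left]
      rw [Valuation.map_neg, map_mul]
      exact (mul_le_of_le_one_left' hb).trans_lt hlt
    refine ⟨_, ⟨(x - b * y) / Nf a b c x y, -y / Nf a b c x y, ?_, ?_, rfl⟩, ?_, ?_⟩
    · refine div_ne_zero ?_ hN0
      rw [← v.ne_zero_iff, h1]; exact hvx
    · rw [map_div₀, map_div₀, h1, Valuation.map_neg, ← mul_div_assoc]
      exact div_le_div_of_nonneg_right hxy zero_le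
    all_goals
      rw [tmat_mul, ← tmat_one a b c]
      congr 1
      · field_simp; unfold Nf; ring
      · field_simp; ring

lemma coset_iff {v : Valuation F Zm0} {a b c : F} (ha : v a ≤ 1) (hb : v b ≤ 1) (hc : v c = 1)
    {n C : ℕ} (hn : 1 ≤ n) (hnC : n ≤ C) {x y x' y' : F}
    (hg : Nf a b c x y ≠ 0) (hs : Nf a b c x' y' ≠ 0) :
    (∃ u ∈ TSet a b c ∩ (ZF F * Kp v n C), tmat a b c x y = tmat a b c x' y' * u) ↔
      v (x' * y - y' * x) ^ 2 ≤ ev C ^ 2 * (v (Nf a b c x' y') * v (Nf a b c x y)) := by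
  have hC : 1 ≤ C := hn.trans hnC
  have hc0 : c ≠ 0 := by rw [← v.ne_zero_iff, hc]; exact one_ne_zero
  set A := x' * x - b * (x * y') + a * c * (y * y') with hA
  set B := x' * y - y' * x with hB
  have hNN : Nf a b c A B = Nf a b c x' y' * Nf a b c x y := by
    rw [hA, hB]; unfold Nf; ring
  have hAB : (∃ u ∈ TSet a b c ∩ (ZF F * Kp v n C), tmat a b c x y = tmat a b c x' y' * u) ↔
      A ≠ 0 ∧ v B ≤ ev C * v A := by
    simp only [memH_iff ha hb hc hn hnC]
    constructor
    · rintro ⟨_, ⟨p, r, hp, hpr, rfl⟩, h⟩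
      rw [tmat_mul] at h
      obtain ⟨h1, h2⟩ := tmat_inj hc0 h
      have eA : A = Nf a b c x' y' * p := by rw [hA, h1, h2]; unfold Nf; ring
      have eB : B = Nf a b c x' y' * r := by rw [hB, h1, h2]; unfold Nf; ring
      rw [eA, eB, map_mul, map_mul, mul_left_comm]
      exact ⟨mul_ne_zero hs hp, by gcongr⟩
    · rintro ⟨h1, h2⟩
      refine ⟨_, ⟨A / Nf a b c x' y', B / Nf a b c x' y', div_ne_zero h1 hs, ?_, rfl⟩, ?_⟩
      · rw [map_div₀, map_div₀, ← mul_div_assoc]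
        exact div_le_div_of_nonneg_right h2 zero_le
      · rw [tmat_mul]
        congr 1
        · field_simp; rw [hA, hB]; unfold Nf; ring
        · field_simp; rw [hA, hB]; unfold Nf; ring
  rw [hAB, ← map_mul, ← hNN]
  constructor
  · rintro ⟨h1, h2⟩
    rw [vNf_dom ha hb hc (dom_lt hC h1 h2), ← mul_pow, sq_le_sq_iff]
    exact h2
  · intro h
    have h3 := h.trans (mul_le_mul_right (vNf_le ha hb hc A B) (ev C ^ 2))
    rw [← mul_pow, sq_le_sq_iff] at h3
    have hlt : v B < v A := by
      by_contra hle
      push Not at hle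
      rw [max_eq_right hle] at h3
      have hB0 : B = 0 := by
        by_contra hB0
        exact absurd (dom_lt hC hB0 h3) (lt_irrefl _)
      have hA0 : A = 0 := by
        rw [hB0, map_zero, le_zero_iff, v.zero_iff] at hle; exact hle
      have : Nf a b c A B = 0 := by rw [hA0, hB0]; simp [Nf]
      rw [hNN] at this
      exact mul_ne_zero hs hg this
    rw [max_eq_left hlt.le] at h3
    exact ⟨by rintro h0; rw [h0, map_zero] at hlt; exact not_lt_zero hlt, h3⟩

lemma reps {v : Valuation F Zm0} {ϖ : F} (hϖ : v ϖ = ev 1) {q : ℕ}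
    (hq : ∃ R : Finset F, R.card = q ∧ (∀ r ∈ R, v r ≤ ev 0) ∧
      ∀ x : F, v x ≤ ev 0 → ∃! r, r ∈ R ∧ v (x - r) ≤ ev 1) (k : ℕ) :
    ∃ T : Finset F, T.card = q ^ k ∧ (∀ r ∈ T, v r ≤ 1) ∧
      ∀ x : F, v x ≤ 1 → ∃! r, r ∈ T ∧ v (x - r) ≤ ev k := by
  classical
  obtain ⟨R, hRc, hR1, hR2⟩ := hq
  simp only [ev_zero] at hR1 hR2
  have hϖ0 : ϖ ≠ 0 := by rw [← v.ne_zero_iff, hϖ]; exact ev_ne 1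
  have hϖ1 : v ϖ ≤ 1 := by rw [hϖ, ← ev_zero, ev_le_iff]; norm_num
  induction k with
  | zero =>
    refine ⟨{0}, by simp, by simp, fun x hx => ⟨0, ⟨by simp, ?_⟩, ?_⟩⟩
    · simpa [ev_zero] using hx
    · rintro y ⟨hy, -⟩
      simpa using hy
  | succ k ih =>
    obtain ⟨T, hTc, hT1, hT2⟩ := ih
    have key : ∀ x r r' : F, v r' ≤ 1 → v (x - (r + ϖ * r')) ≤ ev ((k + 1 : ℕ) : ℤ) →
        v (x - r) ≤ ev 1 := by
      intro x r r' hr' h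
      have e : x - r = (x - (r + ϖ * r')) + ϖ * r' := by ring
      rw [e]
      refine (v.map_add _ _).trans (max_le (h.trans ?_) ?_)
      · rw [ev_le_iff]; push_cast; omega
      · rw [map_mul, hϖ]; exact mul_le_of_le_one_right' hr'
    have key2 : ∀ x r r' : F, v (x - (r + ϖ * r')) ≤ ev ((k + 1 : ℕ) : ℤ) ↔
        v ((x - r) / ϖ - r') ≤ ev k := by
      intro x r r'
      have e : x - (r + ϖ * r') = ϖ * ((x - r) / ϖ - r') := by field_simp; ring
      have e2 : ev ((k + 1 : ℕ) : ℤ) = ev 1 * ev k := by rw [← ev_add]; congr 1; push_cast; ring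
      rw [e, e2, map_mul, hϖ]
      exact mul_le_mul_iff_right₀ (ev_pos 1)
    have hdiv : ∀ z : F, v z ≤ ev 1 → v (z / ϖ) ≤ 1 := by
      intro z hz
      rw [map_div₀, hϖ]
      exact div_le_one_of_le₀ hz zero_le
    refine ⟨(R ×ˢ T).image (fun p => p.1 + ϖ * p.2), ?_, ?_, ?_⟩
    · rw [Finset.card_image_of_injOn, Finset.card_product, hRc, hTc, pow_succ, mul_comm]
      rintro ⟨r, t⟩ h1 ⟨r', t'⟩ h2 h
      simp only [Finset.coe_product, Set.mem_prod, Finset.mem_coe] at h1 h2 h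
      have hx : v (r + ϖ * t) ≤ 1 := by
        refine (v.map_add _ _).trans (max_le (hR1 _ h1.1) ?_)
        rw [map_mul]; exact mul_le_one' hϖ1 (hT1 _ h1.2)
      have a1 := key (r + ϖ * t) r t (hT1 _ h1.2) (by simp)
      have a2 := key (r + ϖ * t) r' t' (hT1 _ h2.2) (by rw [h]; simp)
      have hrr : r = r' := (hR2 _ hx).unique ⟨h1.1, a1⟩ ⟨h2.1, a2⟩
      subst hrr
      have : t = t' := by
        have := add_left_cancel h
        exact mul_left_cancel₀ hϖ0 this
      rw [this]
    · intro r hr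
      simp only [Finset.mem_image, Finset.mem_product, Prod.exists] at hr
      obtain ⟨r, t, ⟨h1, h2⟩, rfl⟩ := hr
      refine (v.map_add _ _).trans (max_le (hR1 _ h1) ?_)
      rw [map_mul]; exact mul_le_one' hϖ1 (hT1 _ h2)
    · intro x hx
      obtain ⟨r, ⟨hr, hxr⟩, -⟩ := hR2 x hx
      obtain ⟨t, ⟨ht, hxt⟩, htu⟩ := hT2 ((x - r) / ϖ) (hdiv _ hxr)
      refine ⟨r + ϖ * t, ⟨Finset.mem_image.2 ⟨(r, t), Finset.mem_product.2 ⟨hr, ht⟩, rfl⟩,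
        (key2 _ _ _).2 hxt⟩, ?_⟩
      rintro y ⟨hy, hxy⟩
      simp only [Finset.mem_image, Finset.mem_product, Prod.exists] at hy
      obtain ⟨r', t', ⟨h1, h2⟩, rfl⟩ := hy
      have hrr : r' = r := (hR2 _ hx).unique ⟨h1, key _ _ _ (hT1 _ h2) hxy⟩ ⟨hr, hxr⟩
      subst hrr
      rw [htu t' ⟨h2, (key2 _ _ _).1 hxy⟩]

lemma reps_scaled {v : Valuation F Zm0} {ϖ : F} (hϖ : v ϖ = ev 1) {q : ℕ}
    (hq : ∃ R : Finset F, R.card = q ∧ (∀ r ∈ R, v r ≤ ev 0) ∧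
      ∀ x : F, v x ≤ ev 0 → ∃! r, r ∈ R ∧ v (x - r) ≤ ev 1) (k : ℕ) :
    ∃ T : Finset F, T.card = q ^ k ∧ (∀ r ∈ T, v r ≤ ev 1) ∧
      ∀ x : F, v x ≤ ev 1 → ∃! r, r ∈ T ∧ v (x - r) ≤ ev k * ev 1 := by
  classical
  obtain ⟨T, h1, h2, h3⟩ := reps hϖ hq k
  have hϖ0 : ϖ ≠ 0 := by rw [← v.ne_zero_iff, hϖ]; exact ev_ne 1
  have key : ∀ x r : F, v (x - ϖ * r) ≤ ev k * ev 1 ↔ v (x / ϖ - r) ≤ ev k := by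
    intro x r
    have e : x - ϖ * r = (x / ϖ - r) * ϖ := by field_simp
    rw [e, map_mul, hϖ]
    exact mul_le_mul_iff_left₀ (ev_pos 1)
  refine ⟨T.image (fun t => ϖ * t), ?_, ?_, ?_⟩
  · rw [Finset.card_image_of_injective _ (mul_right_injective₀ hϖ0), h1]
  · intro r hr
    obtain ⟨t, ht, rfl⟩ := Finset.mem_image.1 hr
    rw [map_mul, hϖ]; exact mul_le_of_le_one_right' (h2 t ht)
  · intro x hx
    have : v (x / ϖ) ≤ 1 := by
      rw [map_div₀, hϖ]
      exact div_le_one_of_le₀ hx zero_le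
    obtain ⟨t, ⟨ht, hxt⟩, hu⟩ := h3 _ this
    refine ⟨ϖ * t, ⟨Finset.mem_image_of_mem _ ht, (key _ _).2 hxt⟩, ?_⟩
    rintro y ⟨hy, hxy⟩
    obtain ⟨t', ht', rfl⟩ := Finset.mem_image.1 hy
    rw [hu t' ⟨ht', (key _ _).1 hxy⟩]

lemma assemble {v : Valuation F Zm0} {a b c : F} (ha : v a ≤ 1) (hb : v b ≤ 1) (hc : v c = 1)
    {n C : ℕ} (hn : 1 ≤ n) (hnC : n ≤ C) {r : F} {ε : Zm0} (hε0 : ε ≠ 0) (hε1 : ε ≤ 1)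
    (hN : ∀ x y : F, v (Nf a b c x y) = max (v (x - r * y) ^ 2) (ε * v y ^ 2))
    (U W : Finset F) (hdis : 1 ∉ U ∨ 1 ∉ W)
    (hW : ∀ w ∈ W, v w ≤ 1) (hU : ∀ u ∈ U, v u ^ 2 ≤ ε)
    (hcase : ∀ X y : F, (X ≠ 0 ∨ y ≠ 0) →
      (X ≠ 0 ∧ ε * v y ^ 2 ≤ v X ^ 2 ∧ (∃! w, w ∈ W ∧ v (y / X - w) ≤ ev C) ∧
        ∀ u ∈ U, v (u * (y / X)) < 1) ∨
      (y ≠ 0 ∧ v X ^ 2 ≤ ε * v y ^ 2 ∧ (∃! u, u ∈ U ∧ v (X / y - u) ≤ ev C * ε) ∧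
        ∀ w ∈ W, v (w * (X / y)) < 1)) :
    ∃ S : Finset (Matrix (Fin 2) (Fin 2) F), S.card = U.card + W.card ∧
          (↑S : Set (Matrix (Fin 2) (Fin 2) F)) ⊆ TSet a b c ∧
          ∀ g ∈ TSet a b c, ∃! s, s ∈ S ∧
            ∃ u ∈ TSet a b c ∩ (ZF F * Kp v n C), g = s * u := by
  classical
  have hC : 1 ≤ C := hn.trans hnC
  have hc0 : c ≠ 0 := by rw [← v.ne_zero_iff, hc]; exact one_ne_zero
  have hNW : ∀ w ∈ W, v (Nf a b c (1 + r * w) w) = 1 := by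
    intro w hw
    rw [hN, add_sub_cancel_right, map_one, one_pow]
    exact max_eq_left (mul_le_one' hε1 (pow_le_one' (hW w hw) 2))
  have hNU : ∀ u ∈ U, v (Nf a b c (u + r) 1) = ε := by
    intro u hu
    rw [hN, mul_one, add_sub_cancel_right, map_one, one_pow, mul_one]
    exact max_eq_right (hU u hu)
  have hNW0 : ∀ w ∈ W, Nf a b c (1 + r * w) w ≠ 0 := by
    intro w hw
    rw [← v.ne_zero_iff, hNW w hw]; exact one_ne_zero
  have hNU0 : ∀ u ∈ U, Nf a b c (u + r) 1 ≠ 0 := by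
    intro u hu
    rw [← v.ne_zero_iff, hNU u hu]; exact hε0
  let f : F → Matrix (Fin 2) (Fin 2) F := fun u => tmat a b c (u + r) 1
  let g : F → Matrix (Fin 2) (Fin 2) F := fun w => tmat a b c (1 + r * w) w
  have hf : Function.Injective f := fun u u' h => by
    simpa using (tmat_inj hc0 h).1
  have hg : Function.Injective g := fun u u' h => (tmat_inj hc0 h).2
  have hfW : ∀ x y : F, Nf a b c x y ≠ 0 → ∀ w ∈ W,
      ((∃ u ∈ TSet a b c ∩ (ZF F * Kp v n C), tmat a b c x y = g w * u) ↔
        v (y - w * (x - r * y)) ^ 2 ≤ ev C ^ 2 * v (Nf a b c x y)) := by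
    intro x y hxy w hw
    rw [coset_iff ha hb hc hn hnC hxy (hNW0 w hw), hNW w hw, one_mul]
    have e : (1 + r * w) * y - w * x = y - w * (x - r * y) := by ring
    rw [e]
  have hfU : ∀ x y : F, Nf a b c x y ≠ 0 → ∀ u ∈ U,
      ((∃ u' ∈ TSet a b c ∩ (ZF F * Kp v n C), tmat a b c x y = f u * u') ↔
        v (u * y - (x - r * y)) ^ 2 ≤ ev C ^ 2 * (ε * v (Nf a b c x y))) := by
    intro x y hxy u hu
    rw [coset_iff ha hb hc hn hnC hxy (hNU0 u hu), hNU u hu]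
    have e : (u + r) * y - 1 * x = u * y - (x - r * y) := by ring
    rw [e]
  have hevC : ev C ^ 2 < 1 := pow_lt_one₀ zero_le (ev_lt_one hC) (by norm_num)
  refine ⟨U.image f ∪ W.image g, ?_, ?_, ?_⟩
  · rw [Finset.card_union_of_disjoint, Finset.card_image_of_injective _ hf,
      Finset.card_image_of_injective _ hg]
    rw [Finset.disjoint_left]
    intro m h1 h2
    obtain ⟨u, hu, rfl⟩ := Finset.mem_image.1 h1
    obtain ⟨w, hw, h⟩ := Finset.mem_image.1 h2
    obtain ⟨h3, h4⟩ := tmat_inj hc0 h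
    subst h4
    have : u = 1 := by rw [mul_one] at h3; exact (add_right_cancel h3).symm
    subst this
    rcases hdis with h | h <;> contradiction
  · intro m hm
    simp only [Finset.coe_union, Finset.coe_image, Set.mem_union, Set.mem_image,
      Finset.mem_coe] at hm
    rcases hm with ⟨u, hu, rfl⟩ | ⟨w, hw, rfl⟩
    · exact ⟨_, _, hNU0 u hu, rfl⟩
    · exact ⟨_, _, hNW0 w hw, rfl⟩
  · rintro _ ⟨x, y, hxy, rfl⟩
    change Nf a b c x y ≠ 0 at hxy
    have hXy : x - r * y ≠ 0 ∨ y ≠ 0 := by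
      by_contra h
      push Not at h
      apply hxy
      rw [← v.zero_iff, hN, h.1, h.2]
      simp
    specialize hfW x y hxy
    specialize hfU x y hxy
    rw [hN] at hfW hfU
    rcases hcase _ _ hXy with ⟨hX, hle, ⟨w, ⟨hw, hw1⟩, hwu⟩, hu⟩ | ⟨hy, hle, ⟨u, ⟨hu, hu1⟩, huu⟩, hw⟩
    · have hvX : 0 < v (x - r * y) ^ 2 := pow_pos (zero_lt_iff.2 ((v.ne_zero_iff).2 hX)) 2
      rw [max_eq_left hle] at hfW hfU
      have kW : ∀ w, v (y - w * (x - r * y)) ^ 2 ≤ ev C ^ 2 * v (x - r * y) ^ 2 ↔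
          v (y / (x - r * y) - w) ≤ ev C := by
        intro w
        have e : y - w * (x - r * y) = (y / (x - r * y) - w) * (x - r * y) := by
          rw [sub_mul, div_mul_cancel₀ _ hX]
        rw [e, map_mul, mul_pow, mul_le_mul_iff_left₀ hvX, sq_le_sq_iff]
      have kU : ∀ u ∈ U, ¬ v (u * y - (x - r * y)) ^ 2 ≤ ev C ^ 2 * (ε * v (x - r * y) ^ 2) := by
        intro u huU
        have e : u * y - (x - r * y) = (u * (y / (x - r * y)) + (-1)) * (x - r * y) := by
          rw [add_mul, mul_assoc, div_mul_cancel₀ _ hX]; ring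
        have e1 : v (u * (y / (x - r * y)) + (-1)) = 1 := by
          rw [Valuation.map_add_eq_of_lt_right, Valuation.map_neg, map_one]
          rw [Valuation.map_neg, map_one]
          exact hu u huU
        rw [e, map_mul, mul_pow, ← mul_assoc, mul_le_mul_iff_left₀ hvX, e1, one_pow, not_le]
        exact (mul_le_of_le_one_right' hε1).trans_lt hevC
      refine ⟨g w, ⟨Finset.mem_union_right _ (Finset.mem_image_of_mem _ hw),
        (hfW w hw).2 ((kW w).2 hw1)⟩, ?_⟩
      rintro s ⟨hs, hs2⟩
      rcases Finset.mem_union.1 hs with h | h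
      · obtain ⟨u, huU, rfl⟩ := Finset.mem_image.1 h
        exact absurd ((hfU u huU).1 hs2) (kU u huU)
      · obtain ⟨w', hw', rfl⟩ := Finset.mem_image.1 h
        rw [hwu w' ⟨hw', (kW w').1 ((hfW w' hw').1 hs2)⟩]
    · have hvy : 0 < v y ^ 2 := pow_pos (zero_lt_iff.2 ((v.ne_zero_iff).2 hy)) 2
      rw [max_eq_right hle] at hfW hfU
      have kU : ∀ u, v (u * y - (x - r * y)) ^ 2 ≤ ev C ^ 2 * (ε * (ε * v y ^ 2)) ↔
          v ((x - r * y) / y - u) ≤ ev C * ε := by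
        intro u
        have e : u * y - (x - r * y) = -(((x - r * y) / y - u) * y) := by field_simp; ring
        have e2 : ev C ^ 2 * (ε * (ε * v y ^ 2)) = (ev C * ε) ^ 2 * v y ^ 2 := by
          rw [mul_pow, sq ε]; simp only [mul_assoc]
        rw [e, e2, Valuation.map_neg, map_mul, mul_pow, mul_le_mul_iff_left₀ hvy, sq_le_sq_iff]
      have kW : ∀ w ∈ W, ¬ v (y - w * (x - r * y)) ^ 2 ≤ ev C ^ 2 * (ε * v y ^ 2) := by
        intro w hwW
        have e : y - w * (x - r * y) = (1 + -(w * ((x - r * y) / y))) * y := by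
          field_simp; ring
        have e1 : v (1 + -(w * ((x - r * y) / y))) = 1 := by
          rw [Valuation.map_add_eq_of_lt_left, map_one]
          rw [Valuation.map_neg, map_one]
          exact hw w hwW
        rw [e, map_mul, mul_pow, ← mul_assoc, mul_le_mul_iff_left₀ hvy, e1, one_pow, not_le]
        exact (mul_le_of_le_one_right' hε1).trans_lt hevC
      refine ⟨f u, ⟨Finset.mem_union_left _ (Finset.mem_image_of_mem _ hu),
        (hfU u hu).2 ((kU u).2 hu1)⟩, ?_⟩
      rintro s ⟨hs, hs2⟩
      rcases Finset.mem_union.1 hs with h | h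
      · obtain ⟨u', hu', rfl⟩ := Finset.mem_image.1 h
        rw [huu u' ⟨hu', (kU u').1 ((hfU u' hu').1 hs2)⟩]
      · obtain ⟨w, hwW, rfl⟩ := Finset.mem_image.1 h
        exact absurd ((hfW w hwW).1 hs2) (kW w hwW)

lemma div_lt_one_aux {v : Valuation F Zm0} {x y : F} (h : v x < v y) : v (x / y) < 1 := by
  rw [map_div₀]
  exact (div_lt_one₀ (lt_of_le_of_lt zero_le h)).2 h

lemma div_le_one_aux {v : Valuation F Zm0} {x y : F} (h : v x ≤ v y) : v (x / y) ≤ 1 := by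
  rw [map_div₀]
  exact div_le_one_of_le₀ h zero_le

lemma ev1_lt : ev 1 < 1 := by rw [← ev_zero, ev_lt_iff]; norm_num

lemma index_unram {v : Valuation F Zm0} {a b c : F} (ha : v a ≤ 1) (hb : v b ≤ 1) (hc : v c = 1)
    {n C : ℕ} (hn : 1 ≤ n) (hnC : n ≤ C) {ϖ : F} (hϖ : v ϖ = ev 1) {q : ℕ}
    (hq : ∃ R : Finset F, R.card = q ∧ (∀ r ∈ R, v r ≤ ev 0) ∧
      ∀ x : F, v x ≤ ev 0 → ∃! r, r ∈ R ∧ v (x - r) ≤ ev 1)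
    (hN : ∀ x y : F, v (Nf a b c x y) = max (v x) (v y) ^ 2) :
    ∃ S : Finset (Matrix (Fin 2) (Fin 2) F), S.card = q ^ C + q ^ (C - 1) ∧
          (↑S : Set (Matrix (Fin 2) (Fin 2) F)) ⊆ TSet a b c ∧
          ∀ g ∈ TSet a b c, ∃! s, s ∈ S ∧
            ∃ u ∈ TSet a b c ∩ (ZF F * Kp v n C), g = s * u := by
  obtain ⟨U, hU1, hU2, hU3⟩ := reps hϖ hq C
  obtain ⟨W, hW1, hW2, hW3⟩ := reps_scaled hϖ hq (C - 1)
  rw [← hU1, ← hW1]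
  have hCe : ev ((C - 1 : ℕ) : ℤ) * ev 1 = ev C := by
    rw [← ev_add]; congr 1; omega
  rw [hCe] at hW3
  have hsq : ∀ x y : F, max (v x) (v y) ^ 2 = max (v x ^ 2) (v y ^ 2) := by
    intro x y
    rcases le_total (v x) (v y) with h | h
    · rw [max_eq_right h, max_eq_right ((sq_le_sq_iff _ _).2 h)]
    · rw [max_eq_left h, max_eq_left ((sq_le_sq_iff _ _).2 h)]
  refine assemble ha hb hc hn hnC (r := 0) (ε := 1) one_ne_zero le_rfl ?_ U W ?_ ?_ ?_ ?_
  · intro x y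
    rw [hN, hsq, zero_mul, sub_zero, one_mul]
  · right
    intro h
    have := hW2 1 h
    rw [map_one] at this
    exact absurd ev1_lt (not_lt.2 this)
  · exact fun w hw => (hW2 w hw).trans ev1_lt.le
  · exact fun u hu => pow_le_one' (hU2 u hu) 2
  · intro X y hXy
    simp only [one_mul, mul_one, sq_le_sq_iff]
    rcases le_or_gt (v X) (v y) with h | h
    · right
      have hy : y ≠ 0 := by
        rintro rfl
        rw [map_zero, le_zero_iff, v.zero_iff] at h
        simp [h] at hXy
      refine ⟨hy, h, hU3 _ (div_le_one_aux h), fun w hw => ?_⟩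
      rw [map_mul]
      exact (mul_le_of_le_one_right' (div_le_one_aux h)).trans_lt ((hW2 w hw).trans_lt ev1_lt)
    · left
      have hX : X ≠ 0 := by
        rintro rfl
        rw [map_zero] at h
        exact not_lt_zero h
      refine ⟨hX, h.le, hW3 _ ((lt_one_iff _).1 (div_lt_one_aux h)), fun u hu => ?_⟩
      rw [map_mul]
      exact (mul_le_of_le_one_left' (hU2 u hu)).trans_lt (div_lt_one_aux h)

lemma index_ram {v : Valuation F Zm0} {a b c : F} (ha : v a ≤ 1) (hb : v b ≤ 1) (hc : v c = 1)
    {n C : ℕ} (hn : 1 ≤ n) (hnC : n ≤ C) {ϖ : F} (hϖ : v ϖ = ev 1) {q : ℕ}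
    (hq : ∃ R : Finset F, R.card = q ∧ (∀ r ∈ R, v r ≤ ev 0) ∧
      ∀ x : F, v x ≤ ev 0 → ∃! r, r ∈ R ∧ v (x - r) ≤ ev 1)
    {r : F} (hN : ∀ x y : F, v (Nf a b c x y) = max (v (x - r * y) ^ 2) (ev 1 * v y ^ 2)) :
    ∃ S : Finset (Matrix (Fin 2) (Fin 2) F), S.card = 2 * q ^ C ∧
          (↑S : Set (Matrix (Fin 2) (Fin 2) F)) ⊆ TSet a b c ∧
          ∀ g ∈ TSet a b c, ∃! s, s ∈ S ∧
            ∃ u ∈ TSet a b c ∩ (ZF F * Kp v n C), g = s * u := by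
  obtain ⟨W, hW1, hW2, hW3⟩ := reps hϖ hq C
  obtain ⟨U, hU1, hU2, hU3⟩ := reps_scaled hϖ hq C
  have hcard : 2 * q ^ C = U.card + W.card := by rw [hU1, hW1]; ring
  rw [hcard]
  refine assemble ha hb hc hn hnC (ev_ne 1) ev1_lt.le hN U W ?_ hW2 ?_ ?_
  · left
    intro h
    have := hU2 1 h
    rw [map_one] at this
    exact absurd ev1_lt (not_lt.2 this)
  · intro u hu
    rw [sq]
    exact (mul_le_of_le_one_right' ((hU2 u hu).trans ev1_lt.le)).trans (hU2 u hu)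
  · intro X y hXy
    rcases lt_or_ge (v X) (v y) with h | h
    · right
      have hy : y ≠ 0 := by
        rintro rfl
        rw [map_zero] at h
        exact not_lt_zero h
      have hvy : 0 < v y := zero_lt_iff.2 ((v.ne_zero_iff).2 hy)
      have h1 : v (X / y) ≤ ev 1 := (lt_one_iff _).1 (div_lt_one_aux h)
      refine ⟨hy, ?_, hU3 _ h1, fun w hw => ?_⟩
      · have e : X = (X / y) * y := by field_simp
        rw [e, map_mul, mul_pow]
        gcongr
        rw [sq]
        exact (mul_le_of_le_one_right' (h1.trans ev1_lt.le)).trans h1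
      · rw [map_mul]
        exact (mul_le_of_le_one_left' (hW2 w hw)).trans_lt (div_lt_one_aux h)
    · left
      have hX : X ≠ 0 := by
        rintro rfl
        rw [map_zero, le_zero_iff, v.zero_iff] at h
        simp [h] at hXy
      refine ⟨hX, ?_, hW3 _ (div_le_one_aux h), fun u hu => ?_⟩
      · exact (mul_le_of_le_one_left' ev1_lt.le).trans ((sq_le_sq_iff _ _).2 h)
      · rw [map_mul]
        exact (mul_le_of_le_one_right' (div_le_one_aux h)).trans_lt ((hU2 u hu).trans_lt ev1_lt)

lemma ext_facts {L : Type*} [Field L] [CharZero F] [Algebra F L]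
    {v : Valuation F Zm0} {vL : Valuation L Zm0}
    {ϖ : F} (hϖ : v ϖ = ev 1)
    {a b c : F} (hc : v c = 1)
    (hnonsq : ∀ r : F, r ^ 2 ≠ b ^ 2 - 4 * (a * c))
    {sqd : L} (hsqd : sqd ^ 2 = algebraMap F L (b ^ 2 - 4 * (a * c)))
    {β : L} (hβ : β = (algebraMap F L b + sqd) / (2 * algebraMap F L c))
    (hbasis : ∀ z : L, vL z ≤ 1 ↔
      ∃ s t : F, v s ≤ 1 ∧ v t ≤ 1 ∧ z = algebraMap F L s + algebraMap F L t * β) :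
    (∀ x y : F, (algebraMap F L x + algebraMap F L (-(c * y)) * β) *
      (algebraMap F L (x - b * y) + algebraMap F L (c * y) * β) =
        algebraMap F L (Nf a b c x y)) ∧
    (∀ s t : F, v s ≤ 1 → v t ≤ 1 → (v s = 1 ∨ v t = 1) →
      ¬ vL (algebraMap F L s + algebraMap F L t * β) ≤ vL (algebraMap F L ϖ)) := by
  have hc0 : c ≠ 0 := by rw [← v.ne_zero_iff, hc]; exact one_ne_zero
  have hinj : Function.Injective (algebraMap F L) := (algebraMap F L).injective
  have hcL : algebraMap F L c ≠ 0 := by simpa using hc0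
  have h2L : (2 : L) ≠ 0 := by
    have : algebraMap F L 2 ≠ 0 := by rw [Ne, map_eq_zero]; exact two_ne_zero
    rwa [map_ofNat] at this
  have hϖ0 : ϖ ≠ 0 := by rw [← v.ne_zero_iff, hϖ]; exact ev_ne 1
  have hϖL0 : algebraMap F L ϖ ≠ 0 := by simpa using hϖ0
  have h2cβ : sqd = 2 * algebraMap F L c * β - algebraMap F L b := by
    rw [hβ]; field_simp; ring
  have hβ2 : algebraMap F L c * β ^ 2 - algebraMap F L b * β + algebraMap F L a = 0 := by
    have h4 : (2 * 2 * algebraMap F L c) *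
        (algebraMap F L c * β ^ 2 - algebraMap F L b * β + algebraMap F L a) = 0 := by
      rw [h2cβ] at hsqd
      simp only [map_sub, map_pow, map_mul, map_ofNat] at hsqd
      linear_combination hsqd
    exact (mul_eq_zero.1 h4).resolve_left (mul_ne_zero (mul_ne_zero h2L h2L) hcL)
  have huniq : ∀ s t : F, algebraMap F L s + algebraMap F L t * β = 0 → s = 0 ∧ t = 0 := by
    intro s t h
    have ht : t = 0 := by
      by_contra ht
      have htL : algebraMap F L t ≠ 0 := by simpa using ht
      have e : β = algebraMap F L (-s / t) := by
        rw [map_div₀, map_neg]; field_simp; linear_combination h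
      apply hnonsq (2 * c * (-s / t) - b)
      apply hinj
      rw [← hsqd, h2cβ, e]
      simp only [map_sub, map_pow, map_mul, map_ofNat]
    subst ht
    simp at h
    exact ⟨h, rfl⟩
  refine ⟨?_, ?_⟩
  · intro x y
    unfold Nf
    simp only [map_sub, map_pow, map_mul, map_neg, map_add]
    linear_combination (-(algebraMap F L y ^ 2 * algebraMap F L c)) * hβ2
  · intro s t hs ht hst h
    have h1 : vL ((algebraMap F L s + algebraMap F L t * β) / algebraMap F L ϖ) ≤ 1 :=
      div_le_one_aux h
    obtain ⟨s', t', hs', ht', e⟩ := (hbasis _).1 h1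
    rw [div_eq_iff hϖL0] at e
    have := huniq (s - s' * ϖ) (t - t' * ϖ) (by
      simp only [map_sub, map_mul]; linear_combination e)
    have a1 : v s < 1 := by
      rw [sub_eq_zero.1 this.1, map_mul, hϖ]
      exact (mul_le_of_le_one_left' hs').trans_lt ev1_lt
    have a2 : v t < 1 := by
      rw [sub_eq_zero.1 this.2, map_mul, hϖ]
      exact (mul_le_of_le_one_left' ht').trans_lt ev1_lt
    rcases hst with h | h
    · exact a1.ne h
    · exact a2.ne h

lemma max_sub_aux {v : Valuation F Zm0} {b : F} (hb : v b ≤ 1) (x y : F) :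
    max (v (x - b * y)) (v y) = max (v x) (v y) := by
  have hby : v (b * y) ≤ v y := by rw [map_mul]; exact mul_le_of_le_one_left' hb
  apply le_antisymm
  · exact max_le ((v.map_sub _ _).trans (max_le_max le_rfl hby)) (le_max_right _ _)
  · refine max_le ?_ (le_max_right _ _)
    have e : x = (x - b * y) + b * y := by ring
    calc v x = v ((x - b * y) + b * y) := by rw [← e]
      _ ≤ _ := (v.map_add _ _).trans (max_le_max le_rfl hby)

lemma norm_unram {L : Type*} [Field L] [CharZero F] [Algebra F L]
    {v : Valuation F Zm0} {vL : Valuation L Zm0}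
    {ϖ : F} (hϖ : v ϖ = ev 1)
    {a b c : F} (hb : v b ≤ 1) (hc : v c = 1)
    (hnonsq : ∀ r : F, r ^ 2 ≠ b ^ 2 - 4 * (a * c))
    {sqd : L} (hsqd : sqd ^ 2 = algebraMap F L (b ^ 2 - 4 * (a * c)))
    {β : L} (hβ : β = (algebraMap F L b + sqd) / (2 * algebraMap F L c))
    (hbasis : ∀ z : L, vL z ≤ 1 ↔
      ∃ s t : F, v s ≤ 1 ∧ v t ≤ 1 ∧ z = algebraMap F L s + algebraMap F L t * β)
    (hv : ∀ x : F, vL (algebraMap F L x) = v x) (x y : F) :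
    v (Nf a b c x y) = max (v x) (v y) ^ 2 := by
  obtain ⟨hmul, hprim⟩ := ext_facts (L := L) (vL := vL) hϖ hc hnonsq hsqd hβ hbasis
  have hunit : ∀ s t : F, v s ≤ 1 → v t ≤ 1 → (v s = 1 ∨ v t = 1) →
      vL (algebraMap F L s + algebraMap F L t * β) = 1 := by
    intro s t hs ht hst
    have h1 : vL (algebraMap F L s + algebraMap F L t * β) ≤ 1 :=
      (hbasis _).2 ⟨s, t, hs, ht, rfl⟩
    refine h1.antisymm (not_lt.1 fun h => ?_)
    apply hprim s t hs ht hst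
    rw [hv, hϖ]
    exact (lt_one_iff _).1 h
  have hmax : ∀ s t : F, vL (algebraMap F L s + algebraMap F L t * β) = max (v s) (v t) := by
    intro s t
    rcases le_total (v t) (v s) with h | h
    · rw [max_eq_left h]
      by_cases hs : s = 0
      · subst hs
        rw [map_zero, le_zero_iff, v.zero_iff] at h
        subst h
        simp
      · have hsL : algebraMap F L s ≠ 0 := by simpa using hs
        have e : algebraMap F L s + algebraMap F L t * β =
            algebraMap F L s * (algebraMap F L 1 + algebraMap F L (t / s) * β) := by
          rw [map_div₀, map_one]; field_simp
        rw [e, map_mul, hunit _ _ (by simp) (div_le_one_aux h) (by simp), hv, mul_one]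
    · rw [max_eq_right h]
      by_cases ht : t = 0
      · subst ht
        rw [map_zero, le_zero_iff, v.zero_iff] at h
        subst h
        simp
      · have htL : algebraMap F L t ≠ 0 := by simpa using ht
        have e : algebraMap F L s + algebraMap F L t * β =
            algebraMap F L t * (algebraMap F L (s / t) + algebraMap F L 1 * β) := by
          rw [map_div₀, map_one]; field_simp
        rw [e, map_mul, hunit _ _ (div_le_one_aux h) (by simp) (by simp), hv, mul_one]
  have hcy : v (c * y) = v y := by rw [map_mul, hc, one_mul]
  rw [← hv, ← hmul, map_mul, hmax, hmax, Valuation.map_neg, hcy, max_sub_aux hb, sq]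

lemma sq_add_odd {L : Type*} [Field L] [Algebra F L]
    {v : Valuation F Zm0} {vL : Valuation L Zm0}
    (hv : ∀ x : F, vL (algebraMap F L x) = v x ^ 2) {ζ : L} (hζ : vL ζ = ev 1) (x y : F) :
    vL (algebraMap F L x + algebraMap F L y * ζ) = max (v x ^ 2) (ev 1 * v y ^ 2) := by
  by_cases hy : y = 0
  · subst hy; simp [hv]
  have h2 : vL (algebraMap F L y * ζ) = ev 1 * v y ^ 2 := by
    rw [map_mul, hv, hζ, mul_comm]
  rw [Valuation.map_add_of_distinct_val, hv, h2]
  rw [hv, h2, mul_comm]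
  intro h
  exact hy ((v.zero_iff).1 (parity _ _ h.symm))

lemma norm_ram {L : Type*} [Field L] [CharZero F] [Algebra F L]
    {v : Valuation F Zm0} {vL : Valuation L Zm0}
    {ϖ : F} (hϖ : v ϖ = ev 1)
    {ϖL : L} (hϖL : vL ϖL = ev 1)
    {a b c : F} (hc : v c = 1)
    (hnonsq : ∀ r : F, r ^ 2 ≠ b ^ 2 - 4 * (a * c))
    {sqd : L} (hsqd : sqd ^ 2 = algebraMap F L (b ^ 2 - 4 * (a * c)))
    {β : L} (hβ : β = (algebraMap F L b + sqd) / (2 * algebraMap F L c))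
    (hbasis : ∀ z : L, vL z ≤ 1 ↔
      ∃ s t : F, v s ≤ 1 ∧ v t ≤ 1 ∧ z = algebraMap F L s + algebraMap F L t * β)
    (hv : ∀ x : F, vL (algebraMap F L x) = v x ^ 2) :
    ∃ r : F, ∀ x y : F, v (Nf a b c x y) = max (v (x - r * y) ^ 2) (ev 1 * v y ^ 2) := by
  obtain ⟨hmul, -⟩ := ext_facts (L := L) (vL := vL) hϖ hc hnonsq hsqd hβ hbasis
  have hc0 : c ≠ 0 := by rw [← v.ne_zero_iff, hc]; exact one_ne_zero
  have hev2 : ev 1 ^ 2 = ev 2 := by rw [ev_pow]; norm_num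
  have hβ1 : vL β ≤ 1 := (hbasis β).2 ⟨0, 1, by simp, by simp, by simp⟩
  obtain ⟨s, t, hs, ht, e⟩ := (hbasis ϖL).1 (by rw [hϖL]; exact ev1_lt.le)
  have ht1 : v t = 1 := by
    refine ht.antisymm (not_lt.1 fun hlt => ?_)
    have h1 : vL (algebraMap F L t * β) ≤ ev 2 := by
      rw [map_mul, hv, ← hev2]
      refine (mul_le_of_le_one_right' hβ1).trans ?_
      rw [sq_le_sq_iff]; exact (lt_one_iff _).1 hlt
    have h12 : ev 2 < ev 1 := by rw [ev_lt_iff]; norm_num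
    have h2 : vL (algebraMap F L s) = ev 1 := by
      have e2 : algebraMap F L s = ϖL + -(algebraMap F L t * β) := by rw [e]; ring
      rw [e2, Valuation.map_add_eq_of_lt_left, hϖL]
      rw [Valuation.map_neg, hϖL]
      exact h1.trans_lt h12
    rw [hv] at h2
    exact one_ne_zero (parity 1 (v s) (by rw [h2]; simp))
  have ht0 : t ≠ 0 := by rw [← v.ne_zero_iff, ht1]; exact one_ne_zero
  have htL : algebraMap F L t ≠ 0 := by simpa using ht0
  set r : F := -(c * s / t) with hr
  set ζ : L := algebraMap F L r + algebraMap F L (-c) * β with hζ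
  set ζ' : L := algebraMap F L (r - b) + algebraMap F L c * β with hζ'
  have hζ1 : vL ζ = ev 1 := by
    have : ζ = algebraMap F L (-(c / t)) * ϖL := by
      rw [hζ, hr, e]; simp only [map_neg, map_div₀, map_mul]; field_simp; ring
    rw [this, map_mul, hv, Valuation.map_neg, map_div₀, hc, ht1, hϖL]; simp
  have hζζ : ζ * ζ' = algebraMap F L (Nf a b c r 1) := by
    rw [← hmul r 1, hζ, hζ']; simp
  have hζ'1 : vL ζ' = ev 1 := by
    have e1 : ζ' = algebraMap F L (2 * r - b) + algebraMap F L (-1) * ζ := by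
      rw [hζ, hζ']; simp only [map_neg, map_sub, map_mul, map_ofNat, map_one]; ring
    have e2 := sq_add_odd hv hζ1 (2 * r - b) (-1)
    rw [← e1, Valuation.map_neg, map_one, one_pow, mul_one] at e2
    rcases le_total (v (2 * r - b) ^ 2) (ev 1) with h | h
    · rw [e2, max_eq_right h]
    · rw [max_eq_left h] at e2
      have e3 := congrArg vL hζζ
      rw [map_mul, hζ1, e2, hv, mul_comm] at e3
      have := parity _ _ e3
      rw [this] at h
      simp [ev_ne 1] at h
  refine ⟨r, fun x y => ?_⟩
  have h1 : algebraMap F L x + algebraMap F L (-(c * y)) * β =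
      algebraMap F L (x - r * y) + algebraMap F L y * ζ := by
    rw [hζ]; simp only [map_neg, map_sub, map_mul]; ring
  have h2 : algebraMap F L (x - b * y) + algebraMap F L (c * y) * β =
      algebraMap F L (x - r * y) + algebraMap F L y * ζ' := by
    rw [hζ']; simp only [map_sub, map_mul]; ring
  rw [← sq_eq_sq_iff, ← hv, ← hmul, h1, h2, map_mul, sq_add_odd hv hζ1, sq_add_odd hv hζ'1]
  exact (sq _).symm

/-- T(F) ∩ Z(F)·K' is a subgroup of T(F) of finite index; the index is
q^C + q^{C−1} if L/F is unramified (v_L(ϖ) = 1) and 2·q^C if L/F is ramified (v_L(ϖ) = 2). -/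
theorem stmt14
    {L : Type*} [Field L] [CharZero F] [Algebra F L]
    (v : Valuation F Zm0) (vL : Valuation L Zm0)
    (ϖ : F) (hϖ : v ϖ = ev 1)
    (ϖL : L) (hϖL : vL ϖL = ev 1)
    (a b c : F)
    (hao : v a ≤ ev 0) (hbo : v b ≤ ev 0) (hc : v c = ev 0)
    (hd0 : b ^ 2 - 4 * (a * c) ≠ 0)
    (hnonsq : ∀ r : F, r ^ 2 ≠ b ^ 2 - 4 * (a * c))
    (sqd : L) (hsqd : sqd ^ 2 = algebraMap F L (b ^ 2 - 4 * (a * c)))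
    (hspan : ∀ z : L, ∃ s t : F, z = algebraMap F L s + algebraMap F L t * sqd)
    (β : L) (hβ : β = (algebraMap F L b + sqd) / (2 * algebraMap F L c))
    -- {1, β} is an 𝔬-basis of 𝔬_L :
    (hbasis : ∀ z : L, vL z ≤ ev 0 ↔
      ∃ s t : F, v s ≤ ev 0 ∧ v t ≤ ev 0 ∧ z = algebraMap F L s + algebraMap F L t * β)
    -- v_L restricted to F is e·v for the ramification index e ≥ 1 :
    (hcomp : ∃ e : ℕ, 0 < e ∧ ∀ x : F, vL (algebraMap F L x) = (v x) ^ e)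
    -- q is the cardinality of the residue field 𝔬/𝔭 :
    (q : ℕ) (hq : ∃ R : Finset F, R.card = q ∧ (∀ r ∈ R, v r ≤ ev 0) ∧
      ∀ x : F, v x ≤ ev 0 → ∃! r, r ∈ R ∧ v (x - r) ≤ ev 1)
    (n C : ℕ) (hn : 1 ≤ n) (hnC : n ≤ C) :
    -- T(F) ∩ Z(F)·K' is a subgroup of T(F) :
    ((1 : Matrix (Fin 2) (Fin 2) F) ∈ TSet a b c ∩ (ZF F * Kp v n C)
      ∧ (∀ x ∈ TSet a b c ∩ (ZF F * Kp v n C), ∀ y ∈ TSet a b c ∩ (ZF F * Kp v n C),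
          x * y ∈ TSet a b c ∩ (ZF F * Kp v n C))
      ∧ (∀ x ∈ TSet a b c ∩ (ZF F * Kp v n C), ∃ y ∈ TSet a b c ∩ (ZF F * Kp v n C),
          x * y = 1 ∧ y * x = 1))
    -- finite index, with index q^C + q^{C−1} in the unramified case :
    ∧ (vL (algebraMap F L ϖ) = ev 1 →
        ∃ S : Finset (Matrix (Fin 2) (Fin 2) F), S.card = q ^ C + q ^ (C - 1) ∧
          (↑S : Set (Matrix (Fin 2) (Fin 2) F)) ⊆ TSet a b c ∧
          ∀ g ∈ TSet a b c, ∃! s, s ∈ S ∧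
            ∃ u ∈ TSet a b c ∩ (ZF F * Kp v n C), g = s * u)
    -- and index 2·q^C in the ramified case :
    ∧ (vL (algebraMap F L ϖ) = ev 2 →
        ∃ S : Finset (Matrix (Fin 2) (Fin 2) F), S.card = 2 * q ^ C ∧
          (↑S : Set (Matrix (Fin 2) (Fin 2) F)) ⊆ TSet a b c ∧
          ∀ g ∈ TSet a b c, ∃! s, s ∈ S ∧
            ∃ u ∈ TSet a b c ∩ (ZF F * Kp v n C), g = s * u) := by
  simp only [ev_zero] at hao hbo hc hbasis
  obtain ⟨e, he0, he⟩ := hcomp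
  refine ⟨subgroup_part hao hbo hc hn hnC, fun h => ?_, fun h => ?_⟩
  · have he1 : e = 1 := by
      rw [he, hϖ, ev_pow, ev_inj_iff] at h; omega
    subst he1
    exact index_unram hao hbo hc hn hnC hϖ hq
      (norm_unram hϖ hbo hc hnonsq hsqd hβ hbasis (by simpa using he))
  · have he2 : e = 2 := by
      rw [he, hϖ, ev_pow, ev_inj_iff] at h; omega
    subst he2
    obtain ⟨r, hr⟩ := norm_ram hϖ hϖL hc hnonsq hsqd hβ hbasis he
    exact index_ram hao hbo hc hn hnC hϖ hq hr
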